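/- arXiv:2604.27400 — 2 statements merged into one kernel-verified Lean document; each statement's English description precedes it below -/
import Mathlib

section
/- Let n ≥ 1, p ∈ ℕ₀^n, and a : ℝ → ℝ be continuously differentiable. Define k : ℝ^{n+1} → ℝ by k(x,ξ_1,…,ξ_n) := (a(x) − a(x−ξ_n))·Φ_p(x;ξ_1,…,ξ_n). Then (i) k(x,ξ_1,…,ξ_{n-1},0) = 0 for all x,ξ_1,…,ξ_{n-1}, and (ii) ∂_x k + ∑_{i=1}^n ∂_{ξ_i} k = a'(x)·Φ_p(x;ξ_1,…,ξ_n) identically on ℝ^{n+1}. -/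
/-- The extended chain `(ξ_0, ξ_1, …, ξ_n)` with the convention `ξ_0 := x`. -/
noncomputable def chainV (n : ℕ) (x : ℝ) (ξ : Fin n → ℝ) : Fin (n + 1) → ℝ :=
  Fin.cases x ξ

/-- The gap-basis polynomial `Φ_p(x; ξ_1, …, ξ_n) = ∏_{j=0}^{n-1} (ξ_j − ξ_{j+1})^{p_j} / p_j!`
with the convention `ξ_0 := x`. -/
noncomputable def Phi (n : ℕ) (p : Fin n → ℕ) (x : ℝ) (ξ : Fin n → ℝ) : ℝ :=
  ∏ j : Fin n,
    (chainV n x ξ j.castSucc - chainV n x ξ j.succ) ^ (p j) / ((p j).factorial : ℝ)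

theorem chainV_translate (n : ℕ) (x t : ℝ) (ξ : Fin n → ℝ) (j : Fin (n + 1)) :
    chainV n (x + t) (fun i => ξ i + t) j = chainV n x ξ j + t := by
  refine Fin.cases ?_ (fun i => ?_) j <;> simp [chainV]

/-- `Phi` depends only on the gaps, so it is invariant under diagonal translation. -/
theorem Phi_translate (n : ℕ) (p : Fin n → ℕ) (x t : ℝ) (ξ : Fin n → ℝ) :
    Phi n p (x + t) (fun i => ξ i + t) = Phi n p x ξ := by
  simp [Phi, chainV_translate]

theorem differentiable_chainV (n : ℕ) (j : Fin (n + 1)) :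
    Differentiable ℝ (fun z : ℝ × (Fin n → ℝ) => chainV n z.1 z.2 j) := by
  refine Fin.cases ?_ (fun i => ?_) j
  · simp [chainV]
  · simp only [chainV, Fin.cases_succ]
    fun_prop

theorem differentiable_Phi (n : ℕ) (p : Fin n → ℕ) :
    Differentiable ℝ (fun z : ℝ × (Fin n → ℝ) => Phi n p z.1 z.2) := by
  have h := differentiable_chainV n
  unfold Phi
  fun_prop

/-- The sum of all partial derivatives is the derivative along the diagonal. -/
theorem deriv_add_sum_deriv_eq_deriv_diagonal {n : ℕ} {F : ℝ → (Fin n → ℝ) → ℝ}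
    {x : ℝ} {ξ : Fin n → ℝ}
    (hF : DifferentiableAt ℝ (fun z : ℝ × (Fin n → ℝ) => F z.1 z.2) (x, ξ)) :
    deriv (fun y => F y ξ) x + ∑ i : Fin n, deriv (fun t => F x (Function.update ξ i t)) (ξ i)
      = deriv (fun t => F (x + t) (fun i => ξ i + t)) 0 := by
  set L := fderiv ℝ (fun z : ℝ × (Fin n → ℝ) => F z.1 z.2) (x, ξ) with hL
  have hF' : HasFDerivAt (fun z : ℝ × (Fin n → ℝ) => F z.1 z.2) L (x, ξ) := hF.hasFDerivAt
  have h₁ : HasDerivAt (fun y => F y ξ) (L (1, 0)) x :=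
    hF'.comp_hasDerivAt_of_eq x ((hasDerivAt_id x).prodMk (hasDerivAt_const x ξ)) rfl
  have h₂ (i : Fin n) :
      HasDerivAt (fun t => F x (Function.update ξ i t)) (L (0, Pi.single i 1)) (ξ i) :=
    hF'.comp_hasDerivAt_of_eq (ξ i)
      ((hasDerivAt_const (ξ i) x).prodMk (hasDerivAt_update ξ i (ξ i))) (by simp)
  have h₃ : HasDerivAt (fun t => F (x + t) (fun i => ξ i + t)) (L (1, fun _ => 1)) 0 :=
    hF'.comp_hasDerivAt_of_eq 0
      (((hasDerivAt_id (0 : ℝ)).const_add x).prodMk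
        (hasDerivAt_pi.2 fun i => (hasDerivAt_id (0 : ℝ)).const_add (ξ i))) (by simp)
  rw [h₁.deriv, h₃.deriv, Finset.sum_congr rfl fun i _ => (h₂ i).deriv, ← map_sum, ← map_add]
  congr 1
  ext j
  · simp [Prod.fst_sum]
  · simp [Prod.snd_sum, Finset.sum_apply, Pi.single_apply]

/-- transport identity for the inflow ansatz
`k(x,ξ) = (a(x) − a(x−ξ_n))·Φ_p(x;ξ)`: it vanishes on the inflow face `ξ_n = 0` and
`(∂_x + ∑_{i=1}^n ∂_{ξ_i}) k = a'(x)·Φ_p(x;ξ)`. -/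
theorem inflow_ansatz_transport_identity (n : ℕ) (hn : 1 ≤ n) (p : Fin n → ℕ)
    (a : ℝ → ℝ) (ha : ContDiff ℝ 1 a)
    (k : ℝ → (Fin n → ℝ) → ℝ)
    (hk : ∀ x ξ, k x ξ = (a x - a (x - ξ ⟨n - 1, by omega⟩)) * Phi n p x ξ) :
    (∀ (x : ℝ) (ξ : Fin n → ℝ), k x (Function.update ξ ⟨n - 1, by omega⟩ 0) = 0) ∧
    (∀ (x : ℝ) (ξ : Fin n → ℝ),
      deriv (fun y => k y ξ) x
        + ∑ i : Fin n, deriv (fun t => k x (Function.update ξ i t)) (ξ i)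
      = deriv a x * Phi n p x ξ) := by
  have ha' : Differentiable ℝ a := ha.differentiable one_ne_zero
  have hΦ := differentiable_Phi n p
  refine ⟨fun x ξ => by simp [hk], fun x ξ => ?_⟩
  rw [deriv_add_sum_deriv_eq_deriv_diagonal (F := k) (by simp only [hk]; fun_prop)]
  simp only [hk, Phi_translate, add_sub_add_right_eq_sub]
  rw [deriv_mul_const (by fun_prop), deriv_sub_const, deriv_comp_const_add, add_zero]
end

section
/- Let n ≥ 2 and let k_n : [0,1] × ℝ^n → ℝ be measurable with C_n := sup_{x∈[0,1]} (∫_{T_n(x)} k_n(x,ξ)² dξ)^{1/2} < ∞. Then the map K_n : L²(0,1) → L²(0,1), K_n[u](x) := ∫_{T_n(x)} k_n(x,ξ) ∏_{i=1}^n u(ξ_i) dξ, is Fréchet differentiable at every u ∈ L²(0,1), with derivative given by (DK_n[u]h)(x) = ∫_{T_n(x)} k_n(x,ξ_1,…,ξ_n) ∑_{j=1}^n h(ξ_j) ∏_{i≠j} u(ξ_i) dξ for h ∈ L²(0,1); moreover for every s > 0, if ‖u‖_{L²(0,1)}² ≤ s then the operator norm satisfies ‖DK_n[u]‖² ≤ C_n²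 · n² s^{n−1}/(n−1)!. -/
open MeasureTheory

/-- The simplex `T_n(x) = {ξ : 0 ≤ ξ_n ≤ ⋯ ≤ ξ_1 ≤ x}`. -/
def simplexT (n : ℕ) (x : ℝ) : Set (Fin n → ℝ) :=
  {ξ | (∀ i j : Fin n, i ≤ j → ξ j ≤ ξ i) ∧ (∀ i, 0 ≤ ξ i) ∧ (∀ i, ξ i ≤ x)}

/-- The order-`n` Volterra term `K_n[u](x) = ∫_{T_n(x)} k_n(x,ξ) ∏_i u(ξ_i) dξ`. -/
noncomputable def volterraTerm (n : ℕ) (k : ℝ → (Fin n → ℝ) → ℝ) (u : ℝ → ℝ) (x : ℝ) : ℝ :=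
  ∫ ξ in simplexT n x, k x ξ * ∏ i : Fin n, u (ξ i)

/-- The candidate Fréchet derivative
`(DK_n[u]h)(x) = ∫_{T_n(x)} k_n(x,ξ) ∑_j h(ξ_j) ∏_{i≠j} u(ξ_i) dξ`. -/
noncomputable def volterraDeriv (n : ℕ) (k : ℝ → (Fin n → ℝ) → ℝ)
    (u h : ℝ → ℝ) (x : ℝ) : ℝ :=
  ∫ ξ in simplexT n x,
    k x ξ * ∑ j : Fin n, h (ξ j) * ∏ i ∈ Finset.univ.erase j, u (ξ i)

/-- The underlying measure of `L²(0,1)`. -/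
noncomputable def μm : Measure ℝ := volume.restrict (Set.Ioo (0:ℝ) 1)

instance : IsFiniteMeasure μm := by unfold μm; infer_instance

/-- Lebesgue measure on the cube `(0,1)^n`. -/
noncomputable abbrev cubeMeasure (n : ℕ) : Measure (Fin n → ℝ) :=
  Measure.pi fun _ : Fin n => μm

theorem cubeMeasure_eq_restrict (n : ℕ) :
    cubeMeasure n = volume.restrict (Set.univ.pi fun _ : Fin n => Set.Ioo (0 : ℝ) 1) := by
  rw [volume_pi, Measure.restrict_pi_pi]; rfl

theorem measurableSet_graph_simplexT (n : ℕ) :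
    MeasurableSet {p : ℝ × (Fin n → ℝ) | p.2 ∈ simplexT n p.1} := by
  simp only [simplexT, Set.mem_ofPred_eq]
  measurability

theorem measurableSet_simplexT (n : ℕ) (x : ℝ) : MeasurableSet (simplexT n x) :=
  (measurableSet_graph_simplexT n).preimage measurable_prodMk_left

/-- The simplex lies in the cube, so only the values on `(0,1)^n` matter there. -/
theorem restrict_simplexT (n : ℕ) {x : ℝ} (hx : x ≤ 1) :
    volume.restrict (simplexT n x) = (cubeMeasure n).restrict (simplexT n x) := by
  rw [cubeMeasure_eq_restrict, Measure.restrict_restrict (measurableSet_simplexT n x)]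
  refine Measure.restrict_congr_set ?_
  have hsub : simplexT n x ⊆ Set.Icc (fun _ => 0) (fun _ => 1) :=
    fun ξ hξ => ⟨fun i => hξ.2.1 i, fun i => (hξ.2.2 i).trans hx⟩
  have hae : (Set.univ.pi fun _ : Fin n => Set.Ioo (0 : ℝ) 1) =ᵐ[volume]
      Set.Icc (fun _ => 0) (fun _ => 1) := by
    rw [volume_pi]; exact Measure.univ_pi_Ioo_ae_eq_Icc
  have := (ae_eq_refl (simplexT n x)).inter hae
  rw [Set.inter_eq_left.2 hsub] at this
  exact this.symm

theorem sq_integral_mul_le {α : Type*} [MeasurableSpace α] {μ : Measure α} {f g : α → ℝ}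
    (hf : MemLp f 2 μ) (hg : MemLp g 2 μ) :
    (∫ a, f a * g a ∂μ) ^ 2 ≤ (∫ a, f a ^ 2 ∂μ) * ∫ a, g a ^ 2 ∂μ := by
  have hfg : Integrable (fun a => f a * g a) μ := hf.integrable_mul hg
  have key : ∀ t : ℝ, 0 ≤ (∫ a, f a ^ 2 ∂μ) * (t * t) + (2 * ∫ a, f a * g a ∂μ) * t
      + ∫ a, g a ^ 2 ∂μ := by
    intro t
    have h0 : 0 ≤ ∫ a, (t * f a + g a) ^ 2 ∂μ := integral_nonneg fun a => sq_nonneg _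
    have h1 : ∫ a, (t * f a + g a) ^ 2 ∂μ
        = ∫ a, (t * t * f a ^ 2 + 2 * t * (f a * g a)) + g a ^ 2 ∂μ := by
      congr 1; ext a; ring
    have hf2 := hf.integrable_sq.const_mul (t * t)
    have hfg2 := hfg.const_mul (2 * t)
    rw [h1, integral_add (f := fun a => t * t * f a ^ 2 + 2 * t * (f a * g a)) (hf2.add hfg2)
      hg.integrable_sq, integral_add hf2 hfg2, integral_const_mul,
      integral_const_mul] at h0
    linarith
  have := discrim_le_zero key
  unfold discrim at this
  nlinarith

/-- The union of the diagonals `ξ_i = ξ_j` is a null set. -/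
theorem ae_injective_cubeMeasure (n : ℕ) :
    ∀ᵐ ξ ∂cubeMeasure n, Function.Injective ξ := by
  rw [cubeMeasure_eq_restrict]
  refine ae_restrict_of_ae ?_
  have h : ∀ i j : Fin n, i ≠ j → ∀ᵐ ξ : Fin n → ℝ, ξ i ≠ ξ j := by
    intro i j hij
    let L : (Fin n → ℝ) →ₗ[ℝ] ℝ :=
      LinearMap.proj (R := ℝ) (φ := fun _ : Fin n => ℝ) i -
        LinearMap.proj (R := ℝ) (φ := fun _ : Fin n => ℝ) j
    have hL : LinearMap.ker L ≠ ⊤ := by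
      intro h
      have : L (Pi.single i 1) = 0 := by
        rw [← LinearMap.mem_ker, h]; trivial
      simp [L, hij.symm] at this
    have := Measure.addHaar_submodule volume _ hL
    rw [ae_iff]
    convert this using 2
    ext ξ
    simp [L, sub_eq_zero]
  have h' : ∀ᵐ ξ : Fin n → ℝ, ∀ i j : Fin n, i ≠ j → ξ i ≠ ξ j := by
    simp only [ae_all_iff]
    exact fun i j hij => h i j hij
  filter_upwards [h'] with ξ hξ i j hij
  by_contra hne
  exact hξ i j hne hij

theorem measurePreserving_comp_perm {n : ℕ} (σ : Equiv.Perm (Fin n)) :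
    MeasurePreserving (fun ξ : Fin n → ℝ => ξ ∘ σ) (cubeMeasure n) (cubeMeasure n) :=
  measurePreserving_arrowCongr' (fun _ => μm) (fun _ => μm) σ.symm (MeasurableEquiv.refl ℝ)
    fun _ => MeasurePreserving.id _

theorem measurableEmbedding_comp_perm {n : ℕ} (σ : Equiv.Perm (Fin n)) :
    MeasurableEmbedding (fun ξ : Fin n → ℝ => ξ ∘ σ) :=
  (MeasurableEquiv.arrowCongr' σ.symm (MeasurableEquiv.refl ℝ)).measurableEmbedding

/-- The `n!` permuted copies of the simplex are essentially disjoint. -/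
theorem factorial_mul_setIntegral_simplexT_le (n : ℕ) (x : ℝ) {f : (Fin n → ℝ) → ℝ}
    (hf : Integrable f (cubeMeasure n)) (hf0 : ∀ ξ, 0 ≤ f ξ)
    (hsymm : ∀ (σ : Equiv.Perm (Fin n)) ξ, f (ξ ∘ σ) = f ξ) :
    (n.factorial : ℝ) * ∫ ξ in simplexT n x, f ξ ∂cubeMeasure n ≤ ∫ ξ, f ξ ∂cubeMeasure n := by
  set S : Set (Fin n → ℝ) := {ξ | ∀ i j : Fin n, i < j → ξ j < ξ i} ∩ simplexT n x with hS
  have hSm : MeasurableSet S := by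
    refine MeasurableSet.inter ?_ (measurableSet_simplexT n x)
    measurability
  have hae : simplexT n x =ᵐ[cubeMeasure n] S := by
    filter_upwards [ae_injective_cubeMeasure n] with ξ hξ
    refine propext ⟨fun h => ⟨fun i j hij => ?_, h⟩, fun h => h.2⟩
    exact lt_of_le_of_ne (h.1 i j hij.le) fun he => hij.ne' (hξ he)
  rw [setIntegral_congr_set hae]
  let T : Equiv.Perm (Fin n) → Set (Fin n → ℝ) := fun σ => (fun ξ => ξ ∘ σ) ⁻¹' S
  have hT : ∀ σ, MeasurableSet (T σ) := fun σ => (measurePreserving_comp_perm σ).measurable hSm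
  have hdisj : Pairwise (Function.onFun Disjoint T) := by
    intro σ τ hστ
    refine Set.disjoint_left.2 fun ξ h1 h2 => hστ ?_
    have a1 : StrictMono (fun i => OrderDual.toDual (ξ (σ i))) := fun i j hij => h1.1 i j hij
    have a2 : StrictMono (fun i => OrderDual.toDual (ξ (τ i))) := fun i j hij => h2.1 i j hij
    have hr : Set.range (fun i => OrderDual.toDual (ξ (σ i)))
        = Set.range (fun i => OrderDual.toDual (ξ (τ i))) :=
      (σ.surjective.range_comp (fun i => OrderDual.toDual (ξ i))).trans
        (τ.surjective.range_comp (fun i => OrderDual.toDual (ξ i))).symm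
    have he := (a1.range_inj a2).1 hr
    have hinj : Function.Injective ξ := by
      intro a b hab
      have : σ.symm a = σ.symm b := a1.injective (by simpa using hab)
      exact σ.symm.injective this
    ext1 i
    exact hinj (congrFun he i)
  have hU := integral_iUnion_fintype (μ := cubeMeasure n) (f := f) hT hdisj
    fun σ => hf.integrableOn
  have hI : ∀ σ, ∫ ξ in T σ, f ξ ∂cubeMeasure n = ∫ ξ in S, f ξ ∂cubeMeasure n := by
    intro σ
    rw [← (measurePreserving_comp_perm σ).setIntegral_preimage_emb
      (measurableEmbedding_comp_perm σ) f S]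
    simp only [hsymm]
    rfl
  simp only [hI, Finset.sum_const, Finset.card_univ, Fintype.card_perm, Fintype.card_fin,
    nsmul_eq_mul] at hU
  rw [← hU]
  exact setIntegral_le_integral hf (Filter.Eventually.of_forall hf0)

theorem norm_sq_eq_integral_sq {α : Type*} [MeasurableSpace α] {μ : Measure α} (f : Lp ℝ 2 μ) :
    ‖f‖ ^ 2 = ∫ a, f a ^ 2 ∂μ := by
  rw [← real_inner_self_eq_norm_sq, L2.inner_def]
  congr 1; ext a
  simp [sq]

theorem measurable_coe_Lp {α : Type*} [MeasurableSpace α] {μ : Measure α} (f : Lp ℝ 2 μ) :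
    Measurable f :=
  (Lp.stronglyMeasurable f).measurable

/-- The tensor product `ξ ↦ ∏ᵢ vᵢ(ξᵢ)`. -/
noncomputable def tensorProd {n : ℕ} (v : Fin n → Lp ℝ 2 μm) (ξ : Fin n → ℝ) : ℝ :=
  ∏ i, v i (ξ i)

section tensor
variable {n : ℕ}

theorem measurable_tensorProd (v : Fin n → Lp ℝ 2 μm) : Measurable (tensorProd v) :=
  Finset.measurable_fun_prod _ fun i _ => (measurable_coe_Lp (v i)).comp (measurable_pi_apply i)

theorem memLp_tensorProd (v : Fin n → Lp ℝ 2 μm) : MemLp (tensorProd v) 2 (cubeMeasure n) := by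
  rw [memLp_two_iff_integrable_sq (measurable_tensorProd v).aestronglyMeasurable]
  simp only [tensorProd, ← Finset.prod_pow]
  exact Integrable.fintype_prod (f := fun i y => v i y ^ 2) fun i => (Lp.memLp (v i)).integrable_sq

theorem integral_tensorProd_sq (v : Fin n → Lp ℝ 2 μm) :
    ∫ ξ, tensorProd v ξ ^ 2 ∂cubeMeasure n = (∏ i, ‖v i‖) ^ 2 := by
  simp only [tensorProd, ← Finset.prod_pow, norm_sq_eq_integral_sq]
  exact integral_fintype_prod_eq_prod (fun i y => v i y ^ 2)

theorem ae_comp_eval {p : ℝ → Prop} (h : ∀ᵐ y ∂μm, p y) (i : Fin n) :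
    ∀ᵐ ξ ∂cubeMeasure n, p (ξ i) :=
  (Measure.quasiMeasurePreserving_eval (fun _ : Fin n => μm) i).ae h

theorem tensorProd_update (v : Fin n → Lp ℝ 2 μm) (j : Fin n) (h : Lp ℝ 2 μm) (ξ : Fin n → ℝ) :
    tensorProd (Function.update v j h) ξ = h (ξ j) * ∏ i ∈ Finset.univ.erase j, v i (ξ i) := by
  rw [tensorProd, ← Finset.mul_prod_erase _ _ (Finset.mem_univ j), Function.update_self]
  congr 1
  refine Finset.prod_congr rfl fun i hi => ?_
  rw [Function.update_of_ne (Finset.ne_of_mem_erase hi)]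

theorem tensorProd_update_add (v : Fin n → Lp ℝ 2 μm) (j : Fin n) (a b : Lp ℝ 2 μm) :
    tensorProd (Function.update v j (a + b)) =ᵐ[cubeMeasure n]
      fun ξ => tensorProd (Function.update v j a) ξ + tensorProd (Function.update v j b) ξ := by
  filter_upwards [ae_comp_eval (Lp.coeFn_add a b) j] with ξ hξ
  simp only [tensorProd_update, hξ, Pi.add_apply, add_mul]

theorem tensorProd_update_smul (v : Fin n → Lp ℝ 2 μm) (j : Fin n) (c : ℝ) (a : Lp ℝ 2 μm) :
    tensorProd (Function.update v j (c • a)) =ᵐ[cubeMeasure n]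
      fun ξ => c * tensorProd (Function.update v j a) ξ := by
  filter_upwards [ae_comp_eval (Lp.coeFn_smul c a) j] with ξ hξ
  simp only [tensorProd_update, hξ, Pi.smul_apply, smul_eq_mul, mul_assoc]

end tensor

theorem Lp_norm_sq_le_of_ae_sq_le {f : Lp ℝ 2 μm} {B : ℝ} (h : ∀ᵐ x ∂μm, f x ^ 2 ≤ B) :
    ‖f‖ ^ 2 ≤ B := by
  rw [norm_sq_eq_integral_sq]
  calc ∫ x, f x ^ 2 ∂μm ≤ ∫ _, B ∂μm :=
        integral_mono_ae (Lp.memLp f).integrable_sq (integrable_const B) h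
    _ = B := by simp [μm, Measure.real]

theorem ae_mem_Icc_μm : ∀ᵐ x ∂μm, x ∈ Set.Icc (0 : ℝ) 1 := by
  filter_upwards [ae_restrict_mem (μ := volume) (measurableSet_Ioo (a := (0 : ℝ)) (b := 1))]
    with x hx using Set.Ioo_subset_Icc_self hx

/-- The Volterra integral of an arbitrary function of `n` variables in place of `∏ᵢ u(ξᵢ)`. -/
noncomputable def volterraIntegral (n : ℕ) (k : ℝ → (Fin n → ℝ) → ℝ) (G : (Fin n → ℝ) → ℝ)
    (x : ℝ) : ℝ :=
  ∫ ξ in simplexT n x, k x ξ * G ξ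

/-- The hypotheses on the kernel: measurability and a uniform `L²` bound `C` on the simplices. -/
structure IsVolterraKernel (n : ℕ) (k : ℝ → (Fin n → ℝ) → ℝ) (C : ℝ) : Prop where
  measurable : Measurable (Function.uncurry k)
  integrableOn_sq : ∀ x ∈ Set.Icc (0:ℝ) 1, IntegrableOn (fun ξ => (k x ξ) ^ 2) (simplexT n x)
  integral_sq_le : ∀ x ∈ Set.Icc (0:ℝ) 1, ∫ ξ in simplexT n x, (k x ξ) ^ 2 ≤ C ^ 2

namespace IsVolterraKernel

variable {n : ℕ} {k : ℝ → (Fin n → ℝ) → ℝ} {C : ℝ}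

theorem memLp (hk : IsVolterraKernel n k C) {x : ℝ} (hx : x ∈ Set.Icc (0:ℝ) 1) :
    MemLp (k x) 2 ((cubeMeasure n).restrict (simplexT n x)) := by
  have hm : Measurable (k x) := hk.measurable.comp measurable_prodMk_left
  rw [memLp_two_iff_integrable_sq hm.aestronglyMeasurable, ← restrict_simplexT n hx.2]
  exact hk.integrableOn_sq x hx

theorem integrable_mul (hk : IsVolterraKernel n k C) {x : ℝ} (hx : x ∈ Set.Icc (0:ℝ) 1)
    {G : (Fin n → ℝ) → ℝ} (hG : MemLp G 2 (cubeMeasure n)) :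
    Integrable (fun ξ => k x ξ * G ξ) (volume.restrict (simplexT n x)) := by
  rw [restrict_simplexT n hx.2]
  exact (hk.memLp hx).integrable_mul (hG.restrict _)

theorem sq_volterraIntegral_le (hk : IsVolterraKernel n k C) {x : ℝ} (hx : x ∈ Set.Icc (0:ℝ) 1)
    {G : (Fin n → ℝ) → ℝ} (hG : MemLp G 2 (cubeMeasure n)) :
    volterraIntegral n k G x ^ 2 ≤ C ^ 2 * ∫ ξ in simplexT n x, G ξ ^ 2 ∂cubeMeasure n := by
  have h := hk.integral_sq_le x hx
  rw [restrict_simplexT n hx.2] at h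
  rw [volterraIntegral, restrict_simplexT n hx.2]
  exact (sq_integral_mul_le (hk.memLp hx) (hG.restrict _)).trans
    (mul_le_mul_of_nonneg_right h (integral_nonneg fun _ => sq_nonneg _))

theorem stronglyMeasurable_volterraIntegral (hk : IsVolterraKernel n k C)
    {G : (Fin n → ℝ) → ℝ} (hG : Measurable G) :
    StronglyMeasurable (volterraIntegral n k G) := by
  have h : volterraIntegral n k G = fun x => ∫ ξ : Fin n → ℝ,
      {p : ℝ × (Fin n → ℝ) | p.2 ∈ simplexT n p.1}.indicator
        (fun p => k p.1 p.2 * G p.2) (x, ξ) := by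
    ext x
    rw [volterraIntegral, ← integral_indicator (measurableSet_simplexT n x)]
    rfl
  rw [h]
  refine StronglyMeasurable.integral_prod_right
    (f := fun x ξ => {p : ℝ × (Fin n → ℝ) | p.2 ∈ simplexT n p.1}.indicator
        (fun p => k p.1 p.2 * G p.2) (x, ξ)) (Measurable.stronglyMeasurable ?_)
  exact (hk.measurable.mul (hG.comp measurable_snd)).indicator (measurableSet_graph_simplexT n)

theorem sq_volterraIntegral_le_integral (hk : IsVolterraKernel n k C) {x : ℝ}
    (hx : x ∈ Set.Icc (0:ℝ) 1)
    {G : (Fin n → ℝ) → ℝ} (hG : MemLp G 2 (cubeMeasure n)) :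
    volterraIntegral n k G x ^ 2 ≤ C ^ 2 * ∫ ξ, G ξ ^ 2 ∂cubeMeasure n :=
  (hk.sq_volterraIntegral_le hx hG).trans <| mul_le_mul_of_nonneg_left
    (setIntegral_le_integral hG.integrable_sq (Filter.Eventually.of_forall fun _ => sq_nonneg _))
    (sq_nonneg C)

theorem memLp_volterraIntegral (hk : IsVolterraKernel n k C)
    {G : (Fin n → ℝ) → ℝ} (hGm : Measurable G)
    (hG : MemLp G 2 (cubeMeasure n)) : MemLp (volterraIntegral n k G) 2 μm := by
  refine MemLp.of_bound (hk.stronglyMeasurable_volterraIntegral hGm).aestronglyMeasurable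
    (Real.sqrt (C ^ 2 * ∫ ξ, G ξ ^ 2 ∂cubeMeasure n)) ?_
  filter_upwards [ae_mem_Icc_μm] with x hx
  exact Real.abs_le_sqrt (hk.sq_volterraIntegral_le_integral hx hG)

/-- The `L²`-valued multilinear map whose diagonal is the Volterra term. -/
noncomputable def multilinearMap (hk : IsVolterraKernel n k C) :
    MultilinearMap ℝ (fun _ : Fin n => Lp ℝ 2 μm) (Lp ℝ 2 μm) :=
  MultilinearMap.mk'
    (fun v => (hk.memLp_volterraIntegral (measurable_tensorProd v) (memLp_tensorProd v)).toLp)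
    (by
      intro v j a b
      rw [← MemLp.toLp_add, MemLp.toLp_eq_toLp_iff]
      filter_upwards [ae_mem_Icc_μm] with x hx
      simp only [Pi.add_apply, volterraIntegral]
      rw [← integral_add (hk.integrable_mul hx (memLp_tensorProd _))
        (hk.integrable_mul hx (memLp_tensorProd _)), restrict_simplexT n hx.2]
      refine integral_congr_ae ?_
      filter_upwards [ae_restrict_of_ae (tensorProd_update_add v j a b)] with ξ hξ
      rw [hξ, mul_add])
    (by
      intro v j c a
      rw [← MemLp.toLp_const_smul, MemLp.toLp_eq_toLp_iff]
      filter_upwards [ae_mem_Icc_μm] with x hx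
      simp only [Pi.smul_apply, volterraIntegral, smul_eq_mul]
      rw [← integral_const_mul, restrict_simplexT n hx.2]
      refine integral_congr_ae ?_
      filter_upwards [ae_restrict_of_ae (tensorProd_update_smul v j c a)] with ξ hξ
      rw [hξ, mul_left_comm])

theorem multilinearMap_ae_eq (hk : IsVolterraKernel n k C) (v : Fin n → Lp ℝ 2 μm) :
    hk.multilinearMap v =ᵐ[μm] volterraIntegral n k (tensorProd v) :=
  MemLp.coeFn_toLp (hk.memLp_volterraIntegral (measurable_tensorProd v) (memLp_tensorProd v))

theorem norm_multilinearMap_le (hk : IsVolterraKernel n k C) (v : Fin n → Lp ℝ 2 μm) :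
    ‖hk.multilinearMap v‖ ≤ |C| * ∏ i, ‖v i‖ := by
  refine abs_le_of_sq_le_sq' ?_ (by positivity) |>.2
  rw [mul_pow, sq_abs, ← integral_tensorProd_sq]
  refine Lp_norm_sq_le_of_ae_sq_le ?_
  filter_upwards [ae_mem_Icc_μm, hk.multilinearMap_ae_eq v] with x hx he
  rw [he]
  exact hk.sq_volterraIntegral_le_integral hx (memLp_tensorProd v)

/-- The multilinear map as a continuous one. -/
noncomputable def continuousMultilinearMap (hk : IsVolterraKernel n k C) :
    ContinuousMultilinearMap ℝ (fun _ : Fin n => Lp ℝ 2 μm) (Lp ℝ 2 μm) :=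
  hk.multilinearMap.mkContinuous |C| hk.norm_multilinearMap_le

/-- The derivative of the Volterra term at `u`. -/
noncomputable def derivCLM (hk : IsVolterraKernel n k C) (u : Lp ℝ 2 μm) :
    Lp ℝ 2 μm →L[ℝ] Lp ℝ 2 μm :=
  (hk.continuousMultilinearMap.linearDeriv fun _ => u).comp
    (ContinuousLinearMap.pi fun _ => ContinuousLinearMap.id ℝ _)

theorem hasFDerivAt_diagonal (hk : IsVolterraKernel n k C) (u : Lp ℝ 2 μm) :
    HasFDerivAt (fun v => hk.continuousMultilinearMap fun _ => v) (hk.derivCLM u) u :=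
  (hk.continuousMultilinearMap.hasFDerivAt fun _ => u).comp u
    (ContinuousLinearMap.pi fun _ : Fin n => ContinuousLinearMap.id ℝ (Lp ℝ 2 μm)).hasFDerivAt

end IsVolterraKernel

/-- The symmetric integrand `∑ⱼ h(ξⱼ) ∏_{i ≠ j} u(ξᵢ)` of the derivative. -/
noncomputable def derivIntegrand (n : ℕ) (u h : Lp ℝ 2 μm) (ξ : Fin n → ℝ) : ℝ :=
  ∑ j, tensorProd (Function.update (fun _ => u) j h) ξ

theorem derivIntegrand_eq (n : ℕ) (u h : Lp ℝ 2 μm) (ξ : Fin n → ℝ) :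
    derivIntegrand n u h ξ = ∑ j, h (ξ j) * ∏ i ∈ Finset.univ.erase j, u (ξ i) := by
  simp only [derivIntegrand, tensorProd_update]

theorem volterraIntegral_derivIntegrand (n : ℕ) (k : ℝ → (Fin n → ℝ) → ℝ) (u h : Lp ℝ 2 μm) :
    volterraIntegral n k (derivIntegrand n u h) = volterraDeriv n k u h := by
  ext x
  simp only [volterraIntegral, volterraDeriv, derivIntegrand_eq]

theorem derivIntegrand_comp_perm {n : ℕ} (u h : Lp ℝ 2 μm) (σ : Equiv.Perm (Fin n))
    (ξ : Fin n → ℝ) : derivIntegrand n u h (ξ ∘ σ) = derivIntegrand n u h ξ := by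
  simp only [derivIntegrand_eq, Function.comp_apply]
  refine Fintype.sum_equiv σ _ _ fun j => ?_
  congr 1
  exact Finset.prod_equiv σ (by simp) fun _ _ => rfl

theorem memLp_derivIntegrand (n : ℕ) (u h : Lp ℝ 2 μm) :
    MemLp (derivIntegrand n u h) 2 (cubeMeasure n) :=
  memLp_finsetSum _ fun _ _ => memLp_tensorProd _

theorem integral_derivIntegrand_sq_le (n : ℕ) (u h : Lp ℝ 2 μm) :
    ∫ ξ, derivIntegrand n u h ξ ^ 2 ∂cubeMeasure n
      ≤ (n : ℝ) ^ 2 * (‖h‖ * ‖u‖ ^ (n - 1)) ^ 2 := by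
  have hint : ∀ j, Integrable
      (fun ξ => tensorProd (Function.update (fun _ : Fin n => u) j h) ξ ^ 2) (cubeMeasure n) :=
    fun j => (memLp_tensorProd _).integrable_sq
  have hterm : ∀ j : Fin n, ∏ i, ‖Function.update (fun _ : Fin n => u) j h i‖
      = ‖h‖ * ‖u‖ ^ (n - 1) := by
    intro j
    rw [← Finset.mul_prod_erase _ _ (Finset.mem_univ j), Function.update_self,
      Finset.prod_congr rfl fun i hi => by
        rw [Function.update_of_ne (Finset.ne_of_mem_erase hi)]]
    simp
  calc ∫ ξ, derivIntegrand n u h ξ ^ 2 ∂cubeMeasure n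
      ≤ ∫ ξ, n * ∑ j, tensorProd (Function.update (fun _ : Fin n => u) j h) ξ ^ 2
          ∂cubeMeasure n := by
        refine integral_mono (memLp_derivIntegrand n u h).integrable_sq
          ((integrable_finsetSum _ fun j _ => hint j).const_mul _) fun ξ => ?_
        simpa [derivIntegrand] using sq_sum_le_card_mul_sum_sq (s := Finset.univ)
          (f := fun j => tensorProd (Function.update (fun _ : Fin n => u) j h) ξ)
    _ = (n : ℝ) ^ 2 * (‖h‖ * ‖u‖ ^ (n - 1)) ^ 2 := by
        rw [integral_const_mul, integral_finsetSum _ fun j _ => hint j]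
        simp only [integral_tensorProd_sq, hterm, Finset.sum_const, Finset.card_univ,
          Fintype.card_fin, nsmul_eq_mul]
        ring

namespace IsVolterraKernel

variable {n : ℕ} {k : ℝ → (Fin n → ℝ) → ℝ} {C : ℝ}

theorem derivCLM_ae_eq (hk : IsVolterraKernel n k C) (u h : Lp ℝ 2 μm) :
    hk.derivCLM u h =ᵐ[μm] volterraIntegral n k (derivIntegrand n u h) := by
  have hsum : hk.derivCLM u h
      = ∑ j, hk.multilinearMap (Function.update (fun _ => u) j h) := by
    simp only [derivCLM, ContinuousLinearMap.comp_apply,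
      ContinuousMultilinearMap.linearDeriv_apply]
    rfl
  have hall : ∀ᵐ x ∂μm, ∀ j, hk.multilinearMap (Function.update (fun _ => u) j h) x
      = volterraIntegral n k (tensorProd (Function.update (fun _ => u) j h)) x :=
    ae_all_iff.2 fun j => hk.multilinearMap_ae_eq _
  rw [hsum]
  filter_upwards [hall, ae_mem_Icc_μm, Lp.coeFn_finsetSum Finset.univ
    fun j => hk.multilinearMap (Function.update (fun _ => u) j h)] with x h1 hx h2
  rw [h2, Finset.sum_apply]
  simp only [h1, volterraIntegral, derivIntegrand, Finset.mul_sum]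
  rw [integral_finsetSum _ fun j _ => hk.integrable_mul hx (memLp_tensorProd _)]

theorem norm_derivCLM_apply_sq_le (hk : IsVolterraKernel n k C) (u h : Lp ℝ 2 μm) :
    ‖hk.derivCLM u h‖ ^ 2
      ≤ C ^ 2 * ((n : ℝ) ^ 2 * (‖h‖ * ‖u‖ ^ (n - 1)) ^ 2 / (n.factorial : ℝ)) := by
  refine Lp_norm_sq_le_of_ae_sq_le ?_
  filter_upwards [ae_mem_Icc_μm, hk.derivCLM_ae_eq u h] with x hx he
  rw [he]
  refine (hk.sq_volterraIntegral_le hx (memLp_derivIntegrand n u h)).trans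
    (mul_le_mul_of_nonneg_left ?_ (sq_nonneg C))
  rw [le_div_iff₀' (by positivity)]
  refine (factorial_mul_setIntegral_simplexT_le n x (memLp_derivIntegrand n u h).integrable_sq
    (fun _ => sq_nonneg _) fun σ ξ => ?_).trans (integral_derivIntegrand_sq_le n u h)
  rw [derivIntegrand_comp_perm]

theorem norm_derivCLM_sq_le (hk : IsVolterraKernel n k C) (u : Lp ℝ 2 μm) :
    ‖hk.derivCLM u‖ ^ 2 ≤ C ^ 2 * ((n : ℝ) ^ 2 * (‖u‖ ^ 2) ^ (n - 1) / (n.factorial : ℝ)) := by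
  have hB : 0 ≤ C ^ 2 * ((n : ℝ) ^ 2 * (‖u‖ ^ 2) ^ (n - 1) / (n.factorial : ℝ)) := by positivity
  rw [← Real.le_sqrt (norm_nonneg _) hB]
  refine ContinuousLinearMap.opNorm_le_bound _ (Real.sqrt_nonneg _) fun h => ?_
  refine abs_le_of_sq_le_sq' ?_ (by positivity) |>.2
  rw [mul_pow, Real.sq_sqrt hB]
  refine (hk.norm_derivCLM_apply_sq_le u h).trans (le_of_eq ?_)
  rw [mul_pow, ← pow_mul, ← pow_mul, mul_comm 2 (n - 1)]
  ring

end IsVolterraKernel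

/-- the order-`n` Volterra term, viewed as a map `L²(0,1) → L²(0,1)`,
is Fréchet differentiable at every `u`, with derivative `h ↦ DK_n[u]h` given by the
explicit formula, and `‖DK_n[u]‖² ≤ C_n² n² s^{n−1}/(n−1)!` whenever `‖u‖² ≤ s`. -/
theorem volterraTerm_frechet_differentiable (n : ℕ) (hn : 2 ≤ n)
    (k : ℝ → (Fin n → ℝ) → ℝ) (hk : Measurable (Function.uncurry k))
    (Cn : ℝ)
    (hki : ∀ x ∈ Set.Icc (0:ℝ) 1, IntegrableOn (fun ξ => (k x ξ) ^ 2) (simplexT n x))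
    (hC : ∀ x ∈ Set.Icc (0:ℝ) 1, ∫ ξ in simplexT n x, (k x ξ) ^ 2 ≤ Cn ^ 2)
    (F : Lp ℝ 2 μm → Lp ℝ 2 μm)
    (hF : ∀ v : Lp ℝ 2 μm, (F v : ℝ → ℝ) =ᵐ[μm] volterraTerm n k v)
    (u : Lp ℝ 2 μm) :
    ∃ D : Lp ℝ 2 μm →L[ℝ] Lp ℝ 2 μm,
      HasFDerivAt F D u ∧
      (∀ h : Lp ℝ 2 μm, (D h : ℝ → ℝ) =ᵐ[μm] volterraDeriv n k u h) ∧
      (∀ s : ℝ, 0 < s → ‖u‖ ^ 2 ≤ s →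
        ‖D‖ ^ 2 ≤ Cn ^ 2 * ((n : ℝ) ^ 2 * s ^ (n - 1) / ((n - 1).factorial : ℝ))) := by
  have hK : IsVolterraKernel n k Cn := ⟨hk, hki, hC⟩
  have hFeq : F = fun v => hK.continuousMultilinearMap fun _ => v := by
    ext1 v
    exact Lp.ext ((hF v).trans (hK.multilinearMap_ae_eq fun _ => v).symm)
  refine ⟨hK.derivCLM u, hFeq ▸ hK.hasFDerivAt_diagonal u, fun h => ?_, fun s hs hus => ?_⟩
  · rw [← volterraIntegral_derivIntegrand]
    exact hK.derivCLM_ae_eq u h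
  · refine (hK.norm_derivCLM_sq_le u).trans ?_
    gcongr
    exact Nat.sub_le n 1
end
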